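/- Both y₀ and α^{-1}·I − y₀ belong to Σ²(X); explicitly, y₀ = α y₀² + Σ_{k=1}^d x_{k0}* x_{k0} and α^{-1}·I − y₀ = α(y₀ − α^{-1}·I)² + Σ_{k=1}^d x_{k0}* x_{k0}. -/

import Mathlib

noncomputable section

/-- The Hilbert space `ℓ²(ℕ^d)`. -/
abbrev L2 (d : ℕ) := lp (fun _ : Fin d → ℕ => ℂ) 2

/-- Bounded operators on `ℓ²(ℕ^d)`. -/
abbrev BdOp (d : ℕ) := L2 d →L[ℂ] L2 d

/-- The standard basis vector `e_𝔫` of `ℓ²(ℕ^d)`. -/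
def e2 (d : ℕ) (n : Fin d → ℕ) : L2 d := lp.single 2 n (1 : ℂ)

/-- The total degree `|𝔫| = n₁ + ⋯ + n_d`. -/
def degIdx (d : ℕ) (n : Fin d → ℕ) : ℕ := ∑ k, n k

/-- The multi-index resulting from applying `a_k` (`k > 0`: annihilation at
slot `k`, `k < 0`: creation at slot `−k`, `k = 0` or `|k| > d`: identity)
to the basis vector `e_𝔫`. -/
def aIdx (d : ℕ) (k : ℤ) (n : Fin d → ℕ) : Fin d → ℕ :=
  if h : 0 < k ∧ k ≤ (d : ℤ) then
    Function.update n ⟨(k - 1).toNat, by omega⟩ (n ⟨(k - 1).toNat, by omega⟩ - 1)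
  else if h' : 0 < -k ∧ -k ≤ (d : ℤ) then
    Function.update n ⟨(-k - 1).toNat, by omega⟩ (n ⟨(-k - 1).toNat, by omega⟩ + 1)
  else n

/-- The coefficient of `a_k e_𝔫`: `√(n_k)` for `k > 0`, `√(n_{−k}+1)` for
`k < 0`, and `1` for `k = 0`, so that `a_k e_𝔫 = (aCoef k 𝔫) • e_{aIdx k 𝔫}`. -/
def aCoef (d : ℕ) (k : ℤ) (n : Fin d → ℕ) : ℝ :=
  if h : 0 < k ∧ k ≤ (d : ℤ) then Real.sqrt (n ⟨(k - 1).toNat, by omega⟩)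
  else if h' : 0 < -k ∧ -k ≤ (d : ℤ) then Real.sqrt (n ⟨(-k - 1).toNat, by omega⟩ + 1)
  else 1

/-- The multi-index of `x_{kl} e_𝔫`. -/
def xIdx (d : ℕ) (k l : ℤ) (n : Fin d → ℕ) : Fin d → ℕ := aIdx d k (aIdx d l n)

/-- The coefficient of `x_{kl} e_𝔫`, where `x_{kl} = a_k a_l (N+α)⁻¹` if
`k ≥ 0` or `l ≥ 0`, and `x_{kl} = (N+α)⁻¹ a_k a_l` if `k < 0` and `l < 0`. -/
def xCoef (d : ℕ) (α : ℝ) (k l : ℤ) (n : Fin d → ℕ) : ℝ :=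
  if 0 ≤ k ∨ 0 ≤ l then aCoef d k (aIdx d l n) * aCoef d l n / (degIdx d n + α)
  else aCoef d k (aIdx d l n) * aCoef d l n / (degIdx d (xIdx d k l n) + α)

/-- The eigenvalue of `y_m = (N + α + m)⁻¹` on `e_𝔫`. -/
def yCoef (d : ℕ) (α : ℝ) (m : ℤ) (n : Fin d → ℕ) : ℝ :=
  ((degIdx d n : ℝ) + α + m)⁻¹

/-- `xop`, `yop` implement the operators `x_{kl}` and `y_n` of Section 3:
each `x_{kl}` (for `|k|, |l| ≤ d`) acts on basis vectors as the continuous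
extension of `a_k a_l (N+α)⁻¹` resp. `(N+α)⁻¹ a_k a_l`, and each `y_m` acts
diagonally with eigenvalue `(|𝔫|+α+m)⁻¹`. -/
def IsXYSystem (d : ℕ) (α : ℝ) (xop : ℤ → ℤ → BdOp d) (yop : ℤ → BdOp d) : Prop :=
  (∀ k l : ℤ, |k| ≤ (d : ℤ) → |l| ≤ (d : ℤ) → ∀ n : Fin d → ℕ,
    xop k l (e2 d n) = (xCoef d α k l n : ℂ) • e2 d (xIdx d k l n)) ∧
  (∀ m : ℤ, ∀ n : Fin d → ℕ, yop m (e2 d n) = (yCoef d α m n : ℂ) • e2 d n)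

/-- The auxiliary ∗-algebra `X`: the unital subalgebra of `B(ℓ²(ℕ^d))`
generated by the `x_{kl}` (`k, l = −d, …, d`) and the `y_n` (`n ∈ ℕ₀`). -/
def Xalg (d : ℕ) (xop : ℤ → ℤ → BdOp d) (yop : ℤ → BdOp d) :
    Subalgebra ℂ (BdOp d) :=
  Algebra.adjoin ℂ
    ({T | ∃ k l : ℤ, |k| ≤ (d : ℤ) ∧ |l| ≤ (d : ℤ) ∧ T = xop k l} ∪
      {T | ∃ m : ℕ, T = yop m})

/-- `Σ²(X)`: finite sums `Σ_i g_i* g_i` with `g_i ∈ X`. -/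
def XSumSq (d : ℕ) (X : Subalgebra ℂ (BdOp d)) : Set (BdOp d) :=
  {T | ∃ (m : ℕ) (g : Fin m → BdOp d),
    (∀ i, g i ∈ X) ∧ T = ∑ i, star (g i) * g i}

/-- Bounded operators on `ℓ²(ℕ^d)` agreeing on the standard basis are equal. -/
theorem BdOp.ext_e2 {d : ℕ} {A B : BdOp d} (h : ∀ n, A (e2 d n) = B (e2 d n)) : A = B := by
  refine lp.ext_continuousLinearMap (by simp) fun n => ?_
  refine ContinuousLinearMap.ext_ring ?_
  simpa [e2] using h n

theorem inner_e2_left (d : ℕ) (n : Fin d → ℕ) (f : L2 d) : inner ℂ (e2 d n) f = f n := by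
  simp [e2, lp.inner_single_left]

theorem e2_apply (d : ℕ) (m n : Fin d → ℕ) :
    (e2 d n : (Fin d → ℕ) → ℂ) m = if m = n then 1 else 0 := by
  simp [e2, lp.single_apply, Pi.single_apply]

/-- An operator sending basis vectors to real multiples of basis vectors, injectively where the
coefficient does not vanish, has a diagonal `T* T`. -/
theorem star_mul_self_apply_e2 {d : ℕ} {T : BdOp d} {c : (Fin d → ℕ) → ℝ}
    {s : (Fin d → ℕ) → Fin d → ℕ} (hT : ∀ n, T (e2 d n) = (c n : ℂ) • e2 d (s n))
    (hs : ∀ m n, c m ≠ 0 → c n ≠ 0 → s m = s n → m = n) (n : Fin d → ℕ) :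
    (star T * T) (e2 d n) = ((c n ^ 2 : ℝ) : ℂ) • e2 d n := by
  ext m
  rw [← inner_e2_left, ← inner_e2_left, ContinuousLinearMap.star_eq_adjoint,
    mul_apply_eq_comp, ContinuousLinearMap.adjoint_inner_right, hT, hT]
  simp only [inner_smul_left, inner_smul_right, inner_e2_left, e2_apply, Complex.conj_ofReal]
  by_cases hmn : m = n
  · subst hmn
    simp [sq]
  · by_cases hm : c m = 0
    · simp [hm, hmn]
    by_cases hn : c n = 0
    · simp [hn]
    have : s m ≠ s n := fun h => hmn (hs m n hm hn h)
    simp [this, hmn]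

theorem star_eq_self_of_diagonal {d : ℕ} {T : BdOp d} {c : (Fin d → ℕ) → ℝ}
    (hT : ∀ n, T (e2 d n) = (c n : ℂ) • e2 d n) : star T = T := by
  refine BdOp.ext_e2 fun n => ?_
  ext m
  rw [← inner_e2_left, ← inner_e2_left, ContinuousLinearMap.star_eq_adjoint,
    ContinuousLinearMap.adjoint_inner_right, hT, hT]
  simp only [inner_smul_left, inner_smul_right, inner_e2_left, e2_apply, Complex.conj_ofReal]
  by_cases hmn : m = n
  · subst hmn
    rfl
  · simp [hmn]

theorem sum_Icc_one_intCast {M : Type*} [AddCommMonoid M] (d : ℕ) (f : ℤ → M) :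
    ∑ k ∈ Finset.Icc (1 : ℤ) (d : ℤ), f k = ∑ i : Fin d, f ((i : ℤ) + 1) := by
  symm
  refine Finset.sum_bij (fun i _ => (i : ℤ) + 1) ?_ ?_ ?_ ?_
  · intro i _
    simp only [Finset.mem_Icc]
    omega
  · intro i _ j _ h
    ext
    simpa using h
  · intro k hk
    rw [Finset.mem_Icc] at hk
    exact ⟨⟨(k - 1).toNat, by omega⟩, Finset.mem_univ _, by simp; omega⟩
  · intros
    rfl

theorem aIdx_zero (d : ℕ) (n : Fin d → ℕ) : aIdx d 0 n = n := by simp [aIdx]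

theorem aCoef_zero (d : ℕ) (n : Fin d → ℕ) : aCoef d 0 n = 1 := by simp [aCoef]

theorem aIdx_succ {d : ℕ} (i : Fin d) (n : Fin d → ℕ) :
    aIdx d ((i : ℤ) + 1) n = Function.update n i (n i - 1) := by
  have h : 0 < (i : ℤ) + 1 ∧ (i : ℤ) + 1 ≤ d := by omega
  simp [aIdx, h]

theorem aCoef_succ {d : ℕ} (i : Fin d) (n : Fin d → ℕ) :
    aCoef d ((i : ℤ) + 1) n = Real.sqrt (n i) := by
  have h : 0 < (i : ℤ) + 1 ∧ (i : ℤ) + 1 ≤ d := by omega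
  simp [aCoef, h]

theorem xIdx_succ_zero {d : ℕ} (i : Fin d) (n : Fin d → ℕ) :
    xIdx d ((i : ℤ) + 1) 0 n = Function.update n i (n i - 1) := by
  rw [xIdx, aIdx_zero, aIdx_succ]

theorem xCoef_succ_zero {d : ℕ} (α : ℝ) (i : Fin d) (n : Fin d → ℕ) :
    xCoef d α ((i : ℤ) + 1) 0 n = Real.sqrt (n i) / (degIdx d n + α) := by
  rw [xCoef, if_pos (Or.inr le_rfl), aIdx_zero, aCoef_zero, aCoef_succ, mul_one]

theorem IsXYSystem.star_xop_mul_xop_apply {d : ℕ} {α : ℝ} {xop : ℤ → ℤ → BdOp d}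
    {yop : ℤ → BdOp d} (hxy : IsXYSystem d α xop yop) (i : Fin d) (n : Fin d → ℕ) :
    (star (xop ((i : ℤ) + 1) 0) * xop ((i : ℤ) + 1) 0) (e2 d n) =
      (((n i : ℝ) / (degIdx d n + α) ^ 2 : ℝ) : ℂ) • e2 d n := by
  have hi : |(i : ℤ) + 1| ≤ d := by
    rw [abs_of_pos (by omega)]
    omega
  have hpos : ∀ m, xCoef d α ((i : ℤ) + 1) 0 m ≠ 0 → m i ≠ 0 := by
    intro m hm h
    simp [xCoef_succ_zero, h] at hm
  rw [star_mul_self_apply_e2 (hxy.1 _ 0 hi (by simp)), xCoef_succ_zero, div_pow,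
    Real.sq_sqrt (Nat.cast_nonneg _)]
  intro p q hp hq h
  have hp := hpos p hp
  have hq := hpos q hq
  rw [xIdx_succ_zero, xIdx_succ_zero] at h
  ext j
  have hj := congrFun h j
  by_cases hji : j = i
  · subst hji
    simp only [Function.update_self] at hj
    omega
  · simpa [hji] using hj

theorem IsXYSystem.yop_zero_eq {d : ℕ} {α : ℝ} (hα : 0 < α) {xop : ℤ → ℤ → BdOp d}
    {yop : ℤ → BdOp d} (hxy : IsXYSystem d α xop yop) :
    yop 0 = (α : ℂ) • (yop 0) ^ 2 +
      ∑ k ∈ Finset.Icc (1 : ℤ) (d : ℤ), star (xop k 0) * xop k 0 := by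
  refine BdOp.ext_e2 fun n => ?_
  have hpos : (0 : ℝ) < degIdx d n + α := by positivity
  have key : yCoef d α 0 n = α * yCoef d α 0 n * yCoef d α 0 n +
      ∑ i, (n i : ℝ) / (degIdx d n + α) ^ 2 := by
    rw [← Finset.sum_div, ← Nat.cast_sum]
    change _ = _ + (degIdx d n : ℝ) / _
    simp only [yCoef, Int.cast_zero, add_zero]
    field_simp
    ring
  rw [sum_Icc_one_intCast, add_apply, sum_apply,
    Finset.sum_congr rfl fun i _ => hxy.star_xop_mul_xop_apply i n, ← Finset.sum_smul,
    smul_apply, pow_two, mul_apply_eq_comp, hxy.2, map_smul, hxy.2,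
    smul_smul, smul_smul, ← add_smul]
  congr 1
  exact_mod_cast key

theorem mem_XSumSq_of_eq_smul_sq_add_sum {d : ℕ} {X : Subalgebra ℂ (BdOp d)} {α : ℝ} (hα : 0 ≤ α)
    {A S : BdOp d} (hA : A ∈ X) (hstar : star A = A) {x : ℤ → BdOp d}
    (hx : ∀ i : Fin d, x ((i : ℤ) + 1) ∈ X)
    (hS : S = (α : ℂ) • A ^ 2 + ∑ k ∈ Finset.Icc (1 : ℤ) (d : ℤ), star (x k) * x k) :
    S ∈ XSumSq d X := by
  refine ⟨d + 1, Fin.cons ((Real.sqrt α : ℂ) • A) fun i => x ((i : ℤ) + 1), ?_, ?_⟩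
  · refine Fin.cases ?_ ?_
    · exact X.smul_mem hA _
    · exact hx
  · rw [hS, Fin.sum_univ_succ, sum_Icc_one_intCast]
    congr 1
    simp only [Fin.cons_zero, star_smul, hstar, smul_mul_smul_comm, pow_two]
    congr 1
    rw [Complex.star_def, Complex.conj_ofReal, ← Complex.ofReal_mul, Real.mul_self_sqrt hα]

/-- Both `y₀` and `α⁻¹·I − y₀` lie in `Σ²(X)`, via the explicit identities
`y₀ = α y₀² + Σ_k x_{k0}* x_{k0}` and
`α⁻¹·I − y₀ = α (y₀ − α⁻¹·I)² + Σ_k x_{k0}* x_{k0}`. -/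
theorem stmt10 (d : ℕ) (hd : 1 ≤ d) (α : ℝ) (hα : 0 < α)
    (hαint : ∀ z : ℤ, α ≠ (z : ℝ))
    (xop : ℤ → ℤ → BdOp d) (yop : ℤ → BdOp d)
    (hxy : IsXYSystem d α xop yop) :
    yop 0 = (α : ℂ) • (yop 0) ^ 2 +
        ∑ k ∈ Finset.Icc (1 : ℤ) (d : ℤ), star (xop k 0) * xop k 0 ∧
    ((α⁻¹ : ℝ) : ℂ) • (1 : BdOp d) - yop 0 =
        (α : ℂ) • (yop 0 - ((α⁻¹ : ℝ) : ℂ) • (1 : BdOp d)) ^ 2 +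
          ∑ k ∈ Finset.Icc (1 : ℤ) (d : ℤ), star (xop k 0) * xop k 0 ∧
    yop 0 ∈ XSumSq d (Xalg d xop yop) ∧
    ((α⁻¹ : ℝ) : ℂ) • (1 : BdOp d) - yop 0 ∈ XSumSq d (Xalg d xop yop) := by
  have h1 := hxy.yop_zero_eq hα
  have hαc : (α : ℂ) ≠ 0 := by exact_mod_cast hα.ne'
  have h2 : ((α⁻¹ : ℝ) : ℂ) • (1 : BdOp d) - yop 0 =
      (α : ℂ) • (yop 0 - ((α⁻¹ : ℝ) : ℂ) • (1 : BdOp d)) ^ 2 +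
        ∑ k ∈ Finset.Icc (1 : ℤ) (d : ℤ), star (xop k 0) * xop k 0 := by
    rw [← sub_eq_iff_eq_add'.2 h1]
    simp only [pow_two, sub_mul, mul_sub, smul_sub, smul_mul_assoc, mul_smul_comm, one_mul,
      mul_one, smul_smul, Complex.ofReal_inv, mul_inv_cancel₀ hαc, one_smul,
      mul_inv_cancel_left₀ hαc]
    abel
  have hy : yop 0 ∈ Xalg d xop yop := Algebra.subset_adjoin (Or.inr ⟨0, rfl⟩)
  have hx (i : Fin d) : xop ((i : ℤ) + 1) 0 ∈ Xalg d xop yop := by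
    refine Algebra.subset_adjoin (Or.inl ⟨_, 0, ?_, by simp, rfl⟩)
    rw [abs_of_pos (by omega)]
    omega
  have hstar : star (yop 0) = yop 0 := star_eq_self_of_diagonal (hxy.2 0)
  refine ⟨h1, h2, mem_XSumSq_of_eq_smul_sq_add_sum (x := fun k => xop k 0) hα.le hy hstar hx h1,
    mem_XSumSq_of_eq_smul_sq_add_sum (x := fun k => xop k 0) hα.le
      (sub_mem hy (Subalgebra.smul_mem _ (one_mem _) _)) ?_ hx h2⟩
  rw [star_sub, hstar, star_smul, star_one, Complex.star_def, Complex.conj_ofReal]
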